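/- arXiv:2405.06954 — 8 statements merged into one kernel-verified Lean document; each statement's English description precedes it below -/
import Mathlib

section
/- Suppose there exist constants c₁, c₂, c₃ > 0 and α > 0 such that for all n ∈ {1,…,N} and all u, v ∈ E: (i) ‖C_n(u) − C_n(v)‖ ≤ (1 + h c₁)‖u − v‖; (ii) ‖F_n(u) − C_n(u)‖ ≤ h^{1+α} c₂; (iii) ‖(F_n(u) − C_n(u)) − (F_n(v) − C_n(v))‖ ≤ h c₃ ‖u − v‖. Then for every k ≥ 0 and every n ∈ {0,1,…,N}, the parareal error satisfies ‖u_n^{(k)} − u_n‖ ≤ h^α · c₂ c₃^k (T − t₀)^{k+1} e^{c₁ (T − t₀)} / (k+1)!. In particular, for fixed k the maximal error max_{0 ≤ n ≤ N} ‖u_n^{(k)} − u_n‖ tends to 0 as h → 0. -/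
/-- A doubly indexed array that satisfies the parareal error recursion is dominated by the
binomial solution of that recursion. -/
theorem le_choose_mul_pow_of_parareal_recursion {N : ℕ} {e : ℕ → ℕ → ℝ} {β a b : ℝ}
    (hβ : 1 ≤ β) (ha : 0 ≤ a) (hb : 0 ≤ b) (he : ∀ k, e k 0 = 0)
    (hzero : ∀ n < N, e 0 (n + 1) ≤ β * e 0 n + a)
    (hsucc : ∀ k, ∀ n < N, e (k + 1) (n + 1) ≤ β * e (k + 1) n + b * e k n)
    (k n : ℕ) (hn : n ≤ N) :
    e k n ≤ a * b ^ k * (n.choose (k + 1) * β ^ n) := by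
  have hβ0 : 0 ≤ β := zero_le_one.trans hβ
  induction n generalizing k with
  | zero => simp [he]
  | succ n ih =>
    have hpow : β ^ n ≤ β ^ (n + 1) := pow_le_pow_right₀ hβ n.le_succ
    cases k with
    | zero =>
      calc e 0 (n + 1) ≤ β * e 0 n + a := hzero n hn
        _ ≤ β * (a * b ^ 0 * (n.choose (0 + 1) * β ^ n)) + a * β ^ (n + 1) := by
            gcongr
            · exact ih 0 (by lia)
            · exact le_mul_of_one_le_right ha (one_le_pow₀ hβ)
        _ = a * b ^ 0 * ((n + 1).choose (0 + 1) * β ^ (n + 1)) := by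
            simp
            ring
    | succ k =>
      calc e (k + 1) (n + 1) ≤ β * e (k + 1) n + b * e k n := hsucc k n hn
        _ ≤ β * (a * b ^ (k + 1) * (n.choose (k + 1 + 1) * β ^ n))
            + b * (a * b ^ k * (n.choose (k + 1) * β ^ (n + 1))) := by
            gcongr
            · exact ih (k + 1) (by lia)
            · exact (ih k (by lia)).trans (by gcongr)
        _ = a * b ^ (k + 1) * ((n + 1).choose (k + 1 + 1) * β ^ (n + 1)) := by
            rw [Nat.choose_succ_succ n (k + 1)]
            push_cast
            ring

/-- Gander–Hairer convergence estimate for the parareal algorithm. -/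
theorem parareal_error_bound
    {E : Type*} [NormedAddCommGroup E] [NormedSpace ℝ E]
    (N : ℕ) (hN : 1 ≤ N) (t₀ T : ℝ) (htT : t₀ < T)
    (h : ℝ) (hh : h = (T - t₀) / N)
    (x₀ : E) (C F : ℕ → E → E)
    (u : ℕ → E) (hu0 : u 0 = x₀)
    (hu : ∀ n, 1 ≤ n → n ≤ N → u n = F n (u (n - 1)))
    (up : ℕ → ℕ → E)
    (hup0 : ∀ k, up k 0 = x₀)
    (hupinit : ∀ n, 1 ≤ n → n ≤ N → up 0 n = C n (up 0 (n - 1)))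
    (hupiter : ∀ k n, 1 ≤ k → 1 ≤ n → n ≤ N →
      up k n = C n (up k (n - 1)) + F n (up (k - 1) (n - 1)) - C n (up (k - 1) (n - 1)))
    (c₁ c₂ c₃ α : ℝ) (hc₁ : 0 < c₁) (hc₂ : 0 < c₂) (hc₃ : 0 < c₃) (hα : 0 < α)
    (hC : ∀ n, 1 ≤ n → n ≤ N → ∀ v w : E,
      ‖C n v - C n w‖ ≤ (1 + h * c₁) * ‖v - w‖)
    (hFC : ∀ n, 1 ≤ n → n ≤ N → ∀ v : E,
      ‖F n v - C n v‖ ≤ h ^ (1 + α) * c₂)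
    (hFCdiff : ∀ n, 1 ≤ n → n ≤ N → ∀ v w : E,
      ‖(F n v - C n v) - (F n w - C n w)‖ ≤ h * c₃ * ‖v - w‖) :
    ∀ k : ℕ, ∀ n : ℕ, n ≤ N →
      ‖up k n - u n‖ ≤
        h ^ α * (c₂ * c₃ ^ k * (T - t₀) ^ (k + 1) * Real.exp (c₁ * (T - t₀)) /
          (Nat.factorial (k + 1) : ℝ)) := by
  intro k n hn
  have hNpos : (0 : ℝ) < N := by exact_mod_cast hN
  have hL : 0 < T - t₀ := sub_pos.2 htT
  have hpos : 0 < h := hh ▸ div_pos hL hNpos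
  have hstep : (n : ℝ) * h ≤ T - t₀ := by
    calc (n : ℝ) * h ≤ N * h := by gcongr
      _ = T - t₀ := by rw [hh]; field_simp
  have hexp : (1 + h * c₁) ^ n ≤ Real.exp (c₁ * (T - t₀)) := by
    calc (1 + h * c₁) ^ n ≤ Real.exp (h * c₁) ^ n := by
          gcongr
          linarith [Real.add_one_le_exp (h * c₁)]
      _ = Real.exp (c₁ * (n * h)) := by rw [← Real.exp_nat_mul]; ring_nf
      _ ≤ Real.exp (c₁ * (T - t₀)) := by gcongr
  have hbound : ‖up k n - u n‖ ≤
      h ^ (1 + α) * c₂ * (h * c₃) ^ k * (n.choose (k + 1) * (1 + h * c₁) ^ n) := by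
    refine le_choose_mul_pow_of_parareal_recursion (e := fun k n => ‖up k n - u n‖)
      (by nlinarith) (by positivity) (by positivity) (fun k => by simp [hup0, hu0])
      (fun m hm => ?_) (fun k m hm => ?_) k n hn
    · have hrec : up 0 (m + 1) - u (m + 1) =
          (C (m + 1) (up 0 m) - C (m + 1) (u m)) - (F (m + 1) (u m) - C (m + 1) (u m)) := by
        rw [hupinit (m + 1) (by lia) hm, hu (m + 1) (by lia) hm, Nat.add_sub_cancel]
        abel
      rw [hrec]
      exact (norm_sub_le _ _).trans
        (add_le_add (hC _ (by lia) hm _ _) (hFC _ (by lia) hm _))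
    · have hrec : up (k + 1) (m + 1) - u (m + 1) =
          (C (m + 1) (up (k + 1) m) - C (m + 1) (u m)) +
          ((F (m + 1) (up k m) - C (m + 1) (up k m)) - (F (m + 1) (u m) - C (m + 1) (u m))) := by
        rw [hupiter (k + 1) (m + 1) (by lia) (by lia) hm, hu (m + 1) (by lia) hm, Nat.add_sub_cancel,
          Nat.add_sub_cancel]
        abel
      rw [hrec]
      exact (norm_add_le _ _).trans
        (add_le_add (hC _ (by lia) hm _ _) (hFCdiff _ (by lia) hm _ _))
  calc ‖up k n - u n‖ ≤
      h ^ (1 + α) * c₂ * (h * c₃) ^ k * (n.choose (k + 1) * (1 + h * c₁) ^ n) := hbound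
    _ ≤ h ^ (1 + α) * c₂ * (h * c₃) ^ k *
        ((n : ℝ) ^ (k + 1) / (k + 1).factorial * Real.exp (c₁ * (T - t₀))) := by
        gcongr
        exact Nat.choose_le_pow_div _ _
    _ = h ^ α * (c₂ * c₃ ^ k * (n * h) ^ (k + 1) * Real.exp (c₁ * (T - t₀)) /
          (k + 1).factorial) := by
        rw [Real.rpow_add hpos, Real.rpow_one]
        ring
    _ ≤ _ := by gcongr
end

section
/- Suppose there exist constants c₁, c₂ > 0 and α > 0 such that for all n ∈ {1,…,N} and all u, v ∈ E: (i) ‖C_n(u) − C_n(v)‖ ≤ (1 + h c₁)‖u − v‖; (ii) ‖F_n(u) − C_n(u)‖ ≤ h^{1+α} c₂. Then for every k ≥ 0 and every n ∈ {0,1,…,N}, the parareal error satisfies ‖u_n^{(k)} − u_n‖ ≤ 2 h^α e^{(T − t₀) c₁} c₂ / c₁. In particular, for fixed k the maximal error max_{0 ≤ n ≤ N} ‖u_n^{(k)} − u_n‖ tends to 0 as h → 0. -/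
/-- Discrete Grönwall inequality for a sequence starting at a nonpositive value, on a finite
range of indices. -/
theorem le_mul_one_add_pow_sub_one {e : ℕ → ℝ} {a B : ℝ} {N : ℕ} (ha : 0 ≤ a) (h0 : e 0 ≤ 0)
    (hstep : ∀ n < N, e (n + 1) ≤ (1 + a) * e n + a * B) {n : ℕ} (hn : n ≤ N) :
    e n ≤ B * ((1 + a) ^ n - 1) := by
  induction n with
  | zero => simpa using h0
  | succ n ih =>
    calc e (n + 1) ≤ (1 + a) * e n + a * B := hstep n hn
      _ ≤ (1 + a) * (B * ((1 + a) ^ n - 1)) + a * B := by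
        gcongr
        exact ih (by lia)
      _ = B * ((1 + a) ^ (n + 1) - 1) := by ring

/-- Convergence of the parareal algorithm without the Lipschitz condition on `F - C`. -/
theorem parareal_error_bound_two_conditions
    {E : Type*} [NormedAddCommGroup E] [NormedSpace ℝ E]
    (N : ℕ) (hN : 1 ≤ N) (t₀ T : ℝ) (htT : t₀ < T)
    (h : ℝ) (hh : h = (T - t₀) / N)
    (x₀ : E) (C F : ℕ → E → E)
    (u : ℕ → E) (hu0 : u 0 = x₀)
    (hu : ∀ n, 1 ≤ n → n ≤ N → u n = F n (u (n - 1)))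
    (up : ℕ → ℕ → E)
    (hup0 : ∀ k, up k 0 = x₀)
    (hupinit : ∀ n, 1 ≤ n → n ≤ N → up 0 n = C n (up 0 (n - 1)))
    (hupiter : ∀ k n, 1 ≤ k → 1 ≤ n → n ≤ N →
      up k n = C n (up k (n - 1)) + F n (up (k - 1) (n - 1)) - C n (up (k - 1) (n - 1)))
    (c₁ c₂ α : ℝ) (hc₁ : 0 < c₁) (hc₂ : 0 < c₂) (hα : 0 < α)
    (hC : ∀ n, 1 ≤ n → n ≤ N → ∀ v w : E,
      ‖C n v - C n w‖ ≤ (1 + h * c₁) * ‖v - w‖)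
    (hFC : ∀ n, 1 ≤ n → n ≤ N → ∀ v : E,
      ‖F n v - C n v‖ ≤ h ^ (1 + α) * c₂) :
    ∀ k : ℕ, ∀ n : ℕ, n ≤ N →
      ‖up k n - u n‖ ≤ 2 * h ^ α * Real.exp ((T - t₀) * c₁) * c₂ / c₁ := by
  intro k n hn
  have hN0 : (0 : ℝ) < N := by exact_mod_cast hN
  have hpos : 0 < h := hh ▸ div_pos (sub_pos.2 htT) hN0
  have hNh : N * h = T - t₀ := by rw [hh]; field_simp
  have hpow : h ^ (1 + α) = h * h ^ α := by rw [Real.rpow_add hpos, Real.rpow_one]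
  have hstep : ∀ m < N, ‖up k (m + 1) - u (m + 1)‖ ≤
      (1 + h * c₁) * ‖up k m - u m‖ + h * c₁ * (2 * h ^ α * c₂ / c₁) := by
    intro m hm
    have hm1 : 1 ≤ m + 1 := by lia
    have hperturb : ‖up k (m + 1) - C (m + 1) (up k m)‖ ≤ h ^ (1 + α) * c₂ := by
      rcases Nat.eq_zero_or_pos k with rfl | hk
      · rw [hupinit (m + 1) hm1 hm, Nat.add_sub_cancel, sub_self, norm_zero]
        positivity
      · rw [hupiter k (m + 1) hk hm1 hm, Nat.add_sub_cancel, add_sub_assoc, add_sub_cancel_left]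
        exact hFC _ hm1 hm _
    have hfine : ‖C (m + 1) (u m) - u (m + 1)‖ ≤ h ^ (1 + α) * c₂ := by
      rw [hu (m + 1) hm1 hm, Nat.add_sub_cancel, norm_sub_rev]
      exact hFC _ hm1 hm _
    have hlip := hC (m + 1) hm1 hm (up k m) (u m)
    have htri : ‖up k (m + 1) - u (m + 1)‖ ≤ ‖up k (m + 1) - C (m + 1) (up k m)‖ +
        ‖C (m + 1) (up k m) - C (m + 1) (u m)‖ + ‖C (m + 1) (u m) - u (m + 1)‖ := by
      refine (norm_sub_le_norm_sub_add_norm_sub _ (C (m + 1) (u m)) _).trans ?_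
      gcongr
      exact norm_sub_le_norm_sub_add_norm_sub _ _ _
    have hsource : h * c₁ * (2 * h ^ α * c₂ / c₁) = 2 * (h ^ (1 + α) * c₂) := by
      rw [hpow]; field_simp
    linarith
  have hexp : (1 + h * c₁) ^ n ≤ Real.exp ((T - t₀) * c₁) :=
    calc (1 + h * c₁) ^ n ≤ (1 + h * c₁) ^ N :=
          pow_le_pow_right₀ (le_add_of_nonneg_right (by positivity)) hn
      _ ≤ Real.exp (h * c₁) ^ N := by
          gcongr
          linarith [Real.add_one_le_exp (h * c₁)]
      _ = Real.exp ((T - t₀) * c₁) := by rw [← Real.exp_nat_mul, ← mul_assoc, hNh]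
  calc ‖up k n - u n‖ ≤ 2 * h ^ α * c₂ / c₁ * ((1 + h * c₁) ^ n - 1) :=
        le_mul_one_add_pow_sub_one (e := fun m => ‖up k m - u m‖) (by positivity)
          (by simp [hup0, hu0]) hstep hn
    _ ≤ 2 * h ^ α * c₂ / c₁ * Real.exp ((T - t₀) * c₁) := by
        gcongr
        linarith
    _ = 2 * h ^ α * Real.exp ((T - t₀) * c₁) * c₂ / c₁ := by ring
end

section
/- Suppose there exist constants b ≥ 0 and a ≥ 0 such that for all n ∈ {1,…,N} and all u, v ∈ E: ‖C_n(u) − C_n(v)‖ ≤ b‖u − v‖ and ‖(F_n(u) − C_n(u)) − (F_n(v) − C_n(v))‖ ≤ a‖u − v‖. Then, writing E_n^{(k)} = ‖u_n^{(k)} − u_n‖, one has for all n ∈ {1,…,N} and all k ≥ 1: E_n^{(k)} ≤ b E_{n−1}^{(k)} + a E_{n−1}^{(k−1)}. -/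
/-- The basic recurrence inequality `E_n^{(k)} ≤ b E_{n-1}^{(k)} + a E_{n-1}^{(k-1)}`
for the parareal error. -/
theorem parareal_error_recurrence
    {E : Type*} [NormedAddCommGroup E] [NormedSpace ℝ E]
    (N : ℕ) (hN : 1 ≤ N)
    (x₀ : E) (C F : ℕ → E → E)
    (u : ℕ → E) (hu0 : u 0 = x₀)
    (hu : ∀ n, 1 ≤ n → n ≤ N → u n = F n (u (n - 1)))
    (up : ℕ → ℕ → E)
    (hup0 : ∀ k, up k 0 = x₀)
    (hupinit : ∀ n, 1 ≤ n → n ≤ N → up 0 n = C n (up 0 (n - 1)))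
    (hupiter : ∀ k n, 1 ≤ k → 1 ≤ n → n ≤ N →
      up k n = C n (up k (n - 1)) + F n (up (k - 1) (n - 1)) - C n (up (k - 1) (n - 1)))
    (a b : ℝ) (hb : 0 ≤ b) (ha : 0 ≤ a)
    (hC : ∀ n, 1 ≤ n → n ≤ N → ∀ v w : E, ‖C n v - C n w‖ ≤ b * ‖v - w‖)
    (hFCdiff : ∀ n, 1 ≤ n → n ≤ N → ∀ v w : E,
      ‖(F n v - C n v) - (F n w - C n w)‖ ≤ a * ‖v - w‖) :
    ∀ k n : ℕ, 1 ≤ k → 1 ≤ n → n ≤ N →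
      ‖up k n - u n‖ ≤ b * ‖up k (n - 1) - u (n - 1)‖ +
        a * ‖up (k - 1) (n - 1) - u (n - 1)‖ := by
  intro k n hk hn hnN
  have hsplit : up k n - u n =
      (C n (up k (n - 1)) - C n (u (n - 1))) +
        ((F n (up (k - 1) (n - 1)) - C n (up (k - 1) (n - 1))) -
          (F n (u (n - 1)) - C n (u (n - 1)))) := by
    rw [hupiter k n hk hn hnN, hu n hn hnN]
    abel
  rw [hsplit]
  exact norm_add_le_of_le (hC n hn hnN _ _) (hFCdiff n hn hnN _ _)
end

section
/- Let γ ≥ 0, a ≥ 0, b ≥ 1, and let E : ℕ × ℕ → ℝ, (n,k) ↦ E_n^{(k)}, be a family of nonnegative reals satisfying E_0^{(k)} = 0 for all k ≥ 0, E_n^{(0)} ≤ b E_{n−1}^{(0)} + γ for all n ≥ 1, and E_n^{(k)} ≤ b E_{n−1}^{(k)} + a E_{n−1}^{(k−1)} for all n ≥ 1 and k ≥ 1. Then for all k ≥ 0 and all n ≥ k + 1: E_n^{(k)} ≤ γ · a^k · b^{n−k−1} · C(n, k+1), where C(n, k+1) = n(n−1)⋯(n−k)/(k+1)! is the binomial coefficient.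 -/
/-- Absorbing a factor `b` into `b ^ (n - k - 1)`; the truncated subtraction is harmless because
the binomial coefficient vanishes when `n ≤ k`. -/
lemma mul_pow_sub_mul_choose (b : ℝ) (n k : ℕ) :
    b * (b ^ (n - k - 1) * (n.choose (k + 1) : ℝ)) = b ^ (n - k) * (n.choose (k + 1) : ℝ) := by
  rcases le_or_gt n k with h | h
  · simp [Nat.choose_eq_zero_of_lt (Nat.lt_succ_of_le h)]
  · rw [← mul_assoc, mul_pow_sub_one (by omega)]

/-- Solution of the double recurrence inequality: `E_n^{(k)} ≤ γ a^k b^(n-k-1) C(n, k+1)`. -/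
theorem double_recurrence_bound
    (γ a b : ℝ) (hγ : 0 ≤ γ) (ha : 0 ≤ a) (hb : 1 ≤ b)
    (Err : ℕ → ℕ → ℝ)
    (hnonneg : ∀ n k, 0 ≤ Err n k)
    (hzero : ∀ k, Err 0 k = 0)
    (hinit : ∀ n, 1 ≤ n → Err n 0 ≤ b * Err (n - 1) 0 + γ)
    (hrec : ∀ n k, 1 ≤ n → 1 ≤ k →
      Err n k ≤ b * Err (n - 1) k + a * Err (n - 1) (k - 1)) :
    ∀ k n : ℕ, k + 1 ≤ n →
      Err n k ≤ γ * a ^ k * b ^ (n - k - 1) * (Nat.choose n (k + 1) : ℝ) := by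
  have hb0 : 0 ≤ b := zero_le_one.trans hb
  suffices h : ∀ n k : ℕ,
      Err n k ≤ γ * a ^ k * b ^ (n - k - 1) * (Nat.choose n (k + 1) : ℝ) from
    fun k n _ => h n k
  intro n
  induction n with
  | zero => simp [hzero]
  | succ n ih =>
    rintro (_ | k)
    · calc Err (n + 1) 0 ≤ b * Err n 0 + γ := hinit (n + 1) (by omega)
        _ ≤ b * (γ * a ^ 0 * b ^ (n - 0 - 1) * (n.choose (0 + 1) : ℝ)) + γ * b ^ n := by
          gcongr
          · exact ih 0
          · exact le_mul_of_one_le_right hγ (one_le_pow₀ hb)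
        _ = γ * (b * (b ^ (n - 0 - 1) * (n.choose (0 + 1) : ℝ))) + γ * b ^ n := by ring
        _ = γ * a ^ 0 * b ^ (n + 1 - 0 - 1) * ((n + 1).choose (0 + 1) : ℝ) := by
          rw [mul_pow_sub_mul_choose]
          simp
          ring
    · calc Err (n + 1) (k + 1) ≤ b * Err n (k + 1) + a * Err n k :=
            hrec (n + 1) (k + 1) (by omega) (by omega)
        _ ≤ b * (γ * a ^ (k + 1) * b ^ (n - (k + 1) - 1) * (n.choose (k + 1 + 1) : ℝ)) +
            a * (γ * a ^ k * b ^ (n - k - 1) * (n.choose (k + 1) : ℝ)) := by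
          gcongr
          · exact ih (k + 1)
          · exact ih k
        _ = γ * a ^ (k + 1) * (b * (b ^ (n - (k + 1) - 1) * (n.choose (k + 1 + 1) : ℝ))) +
            γ * a ^ (k + 1) * b ^ (n - k - 1) * (n.choose (k + 1) : ℝ) := by ring
        _ = γ * a ^ (k + 1) * b ^ (n + 1 - (k + 1) - 1) *
            ((n + 1).choose (k + 1 + 1) : ℝ) := by
          rw [mul_pow_sub_mul_choose, Nat.choose_succ_succ n (k + 1), Nat.add_sub_add_right,
            Nat.sub_add_eq]
          push_cast
          ring
end

section
/- Let f : ℝ × ℝᵈ → ℝᵈ be continuously differentiable. Fix t ∈ ℝ and u ∈ ℝᵈ. Then the map h ↦ F₄(h,t,u;f) takes the value f(t,u) at h = 0 and is differentiable at h = 0 with derivative (1/2)(∂_t f(t,u) + (D_x f(t,u))(f(t,u))), where ∂_t f denotes the partial derivative in the time variable and D_x f(t,u) the (Fréchet) derivative of f(t,·) at u. Equivalently, F₄(h,t,u;f) − f(t,u) = (h/2)(∂_t f(t,u) + (D_x f(t,u))(f(t,u))) + o(h) as h → 0. -/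
/-- The classical four-stage Runge–Kutta increment function
`F₄(h,t,u;f) = (k₁ + 2k₂ + 2k₃ + k₄)/6`. -/
noncomputable def rkF4 {E : Type*} [NormedAddCommGroup E] [NormedSpace ℝ E]
    (f : ℝ → E → E) (h t : ℝ) (u : E) : E :=
  let k₁ := f t u
  let k₂ := f (t + h / 2) (u + (h / 2) • k₁)
  let k₃ := f (t + h / 2) (u + (h / 2) • k₂)
  let k₄ := f (t + h) (u + h • k₃)
  (1 / 6 : ℝ) • (k₁ + (2 : ℝ) • k₂ + (2 : ℝ) • k₃ + k₄)

/-- A Runge–Kutta stage `h ↦ f (t + a h, u + a h • k h)`, where `a 0 = 0`, `a` has derivative `c`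
at `0` and `k` is differentiable at `0`, has derivative `c • Df(t,u)(1, k 0)` at `h = 0`. -/
theorem hasDerivAt_rkStage {E : Type*} [NormedAddCommGroup E] [NormedSpace ℝ E]
    {f : ℝ × E → E} {t : ℝ} {u : E} (hf : DifferentiableAt ℝ f (t, u)) {a : ℝ → ℝ} {c : ℝ}
    (ha : HasDerivAt a c 0) (ha₀ : a 0 = 0) {k : ℝ → E} {k' : E} (hk : HasDerivAt k k' 0) :
    HasDerivAt (fun h : ℝ => f (t + a h, u + a h • k h))
      (c • fderiv ℝ f (t, u) (1, k 0)) 0 := by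
  have hp : HasDerivAt (fun h : ℝ => (t + a h, u + a h • k h)) (c • ((1 : ℝ), k 0)) 0 := by
    simpa [ha₀] using (ha.const_add t).prodMk ((ha.smul hk).const_add u)
  have hF : HasFDerivAt f (fderiv ℝ f (t, u)) (t + a 0, u + a 0 • k 0) := by
    simpa [ha₀] using hf.hasFDerivAt
  rw [← map_smul]
  exact hF.comp_hasDerivAt 0 hp

/-- The Runge–Kutta increment `h ↦ F₄(h,t,u;f)` has derivative `(1/2) Df(t,u)(1, f(t,u))`
at `h = 0` as soon as `f` is differentiable at `(t,u)`. -/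
theorem hasDerivAt_rkF4_zero {E : Type*} [NormedAddCommGroup E] [NormedSpace ℝ E]
    {f : ℝ × E → E} {t : ℝ} {u : E} (hf : DifferentiableAt ℝ f (t, u)) :
    HasDerivAt (fun h : ℝ => rkF4 (fun s x => f (s, x)) h t u)
      ((1 / 2 : ℝ) • fderiv ℝ f (t, u) (1, f (t, u))) 0 := by
  have half : HasDerivAt (fun h : ℝ => h / 2) (1 / 2) 0 := (hasDerivAt_id 0).div_const 2
  have h₁ : HasDerivAt (fun _ : ℝ => f (t, u)) 0 0 := hasDerivAt_const _ _
  have h₂ := hasDerivAt_rkStage hf half (zero_div 2) h₁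
  have h₃ := hasDerivAt_rkStage hf half (zero_div 2) h₂
  have h₄ := hasDerivAt_rkStage hf (hasDerivAt_id 0) rfl h₃
  refine HasDerivAt.congr_deriv ((((h₁.add (h₂.const_smul (2 : ℝ))).add
    (h₃.const_smul (2 : ℝ))).add h₄).const_smul (1 / 6 : ℝ)) ?_
  simp only [zero_div, zero_smul, add_zero]
  module

/-- For continuously differentiable `f`, the Runge–Kutta increment `h ↦ F₄(h,t,u;f)`
equals `f(t,u)` at `h = 0` and is differentiable there with derivative
`(1/2)(∂ₜf(t,u) + (Dₓf(t,u))(f(t,u)))`. -/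
theorem rkF4_expansion_at_zero
    (d : ℕ) (f : ℝ × EuclideanSpace ℝ (Fin d) → EuclideanSpace ℝ (Fin d))
    (hf : ContDiff ℝ 1 f)
    (t : ℝ) (u : EuclideanSpace ℝ (Fin d)) :
    rkF4 (fun s x => f (s, x)) 0 t u = f (t, u) ∧
    HasDerivAt (fun h : ℝ => rkF4 (fun s x => f (s, x)) h t u)
      ((1 / 2 : ℝ) • (fderiv ℝ f (t, u) (1, 0) + fderiv ℝ f (t, u) (0, f (t, u)))) 0 := by
  refine ⟨?_, ?_⟩
  · simp only [rkF4, zero_div, zero_smul, add_zero]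
    module
  · rw [← map_add, Prod.mk_add_mk, add_zero, zero_add]
    exact hasDerivAt_rkF4_zero (hf.differentiable one_ne_zero _)
end

section
/- Let f : ℝ × ℝᵈ → ℝᵈ be continuously differentiable and let K ⊂ ℝ × ℝᵈ be compact. Then there exist constants Λ > 0 and h₀ > 0 such that for all (t,u) ∈ K and all h with 0 ≤ h ≤ h₀: ‖F₄(h,t,u;f) − f(t,u)‖ ≤ Λ h. Consequently, for the Euler coarse integrator C(u) = u + h f(t,u) and the one-step Runge–Kutta fine integrator F(u) = u + h F₄(h,t,u;f), one has ‖F(u) − C(u)‖ ≤ Λ h² for all (t,u) ∈ K and 0 ≤ h ≤ h₀. -/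
/-- With step size zero, the Runge–Kutta increment is the vector field itself. -/
theorem rkF4_zero {E : Type*} [NormedAddCommGroup E] [NormedSpace ℝ E]
    (f : ℝ → E → E) (t : ℝ) (u : E) : rkF4 f 0 t u = f t u := by
  simp only [rkF4, zero_div, zero_smul, add_zero]
  module

/-- The Runge–Kutta increment is as smooth in `(h, t, u)` as the vector field. -/
theorem ContDiff.rkF4 {E : Type*} [NormedAddCommGroup E] [NormedSpace ℝ E]
    {n : WithTop ℕ∞} {f : ℝ × E → E} (hf : ContDiff ℝ n f) :
    ContDiff ℝ n fun q : ℝ × ℝ × E => rkF4 (fun s x => f (s, x)) q.1 q.2.1 q.2.2 := by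
  unfold _root_.rkF4
  fun_prop

/-- A `C¹` function of `(h, p)` is Lipschitz in `h` at `h = 0`, uniformly for `h ∈ [0, 1]` and
`p` in a compact set. -/
theorem ContDiff.exists_norm_sub_le_mul_of_isCompact {P E : Type*}
    [NormedAddCommGroup P] [NormedSpace ℝ P] [NormedAddCommGroup E] [NormedSpace ℝ E]
    {G : ℝ × P → E} (hG : ContDiff ℝ 1 G) {K : Set P} (hK : IsCompact K) :
    ∃ Λ > (0 : ℝ), ∀ p ∈ K, ∀ h : ℝ, 0 ≤ h → h ≤ 1 → ‖G (h, p) - G (0, p)‖ ≤ Λ * h := by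
  obtain ⟨C, hC⟩ := ((isCompact_Icc (a := (0 : ℝ)) (b := 1)).prod hK).exists_bound_of_continuousOn
    (hG.continuous_fderiv one_ne_zero).continuousOn
  refine ⟨max C 1, by positivity, fun p hp h h0 h1 => ?_⟩
  have hmv := ((convex_Icc (0 : ℝ) 1).prod (convex_singleton p)).norm_image_sub_le_of_norm_fderiv_le
    (𝕜 := ℝ) (f := G) (C := max C 1) (x := (0, p)) (y := (h, p))
    (fun x _ => (hG.differentiable one_ne_zero) x)
    (fun x hx => (hC x ⟨hx.1, by rwa [Set.mem_singleton_iff.mp hx.2]⟩).trans (le_max_left _ _))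
    ⟨⟨le_rfl, zero_le_one⟩, rfl⟩ ⟨⟨h0, h1⟩, rfl⟩
  simpa [Prod.norm_def, abs_of_nonneg h0, h0] using hmv

/-- On a compact set, `‖F₄(h,t,u;f) − f(t,u)‖ ≤ Λh`, hence the difference between
the one-step Runge–Kutta fine integrator and the Euler coarse integrator is `O(h²)`. -/
theorem rkF4_minus_f_bound_on_compact
    (d : ℕ) (f : ℝ × EuclideanSpace ℝ (Fin d) → EuclideanSpace ℝ (Fin d))
    (hf : ContDiff ℝ 1 f)
    (K : Set (ℝ × EuclideanSpace ℝ (Fin d))) (hK : IsCompact K) :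
    ∃ Λ > (0 : ℝ), ∃ h₀ > (0 : ℝ), ∀ p ∈ K, ∀ h : ℝ, 0 ≤ h → h ≤ h₀ →
      ‖rkF4 (fun s x => f (s, x)) h p.1 p.2 - f p‖ ≤ Λ * h ∧
      ‖(p.2 + h • rkF4 (fun s x => f (s, x)) h p.1 p.2) - (p.2 + h • f p)‖ ≤ Λ * h ^ 2 := by
  obtain ⟨Λ, hΛ, hbound⟩ := hf.rkF4.exists_norm_sub_le_mul_of_isCompact hK
  refine ⟨Λ, hΛ, 1, one_pos, fun p hp h h0 h1 => ?_⟩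
  have hinc : ‖rkF4 (fun s x => f (s, x)) h p.1 p.2 - f p‖ ≤ Λ * h := by
    simpa only [rkF4_zero] using hbound p hp h h0 h1
  refine ⟨hinc, ?_⟩
  rw [add_sub_add_left_eq_sub, ← smul_sub, norm_smul, Real.norm_of_nonneg h0]
  calc h * ‖rkF4 (fun s x => f (s, x)) h p.1 p.2 - f p‖ ≤ h * (Λ * h) := by gcongr
    _ = Λ * h ^ 2 := by ring
end

section
/- Let E be a real normed vector space, L > 0, h ≥ 0, and let f : ℝ × E → E satisfy ‖f(t,u) − f(t,v)‖ ≤ L‖u − v‖ for all t ∈ ℝ and u, v ∈ E. Define the coarse (Euler) integrator C(u) = u + h f(t,u) and the fine integrator F(u) = u + h F₄(h,t,u;f) for a fixed t ∈ ℝ. Then for all u, v ∈ E: ‖(F(u) − C(u)) − (F(v) − C(v))‖ ≤ h (L + M) ‖u − v‖, where M = L(1 + (1/2)hL + (1/6)h²L² + (1/24)h³L³). -/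
/-- A Runge–Kutta stage `u ↦ f(s, u + a k(u))` inherits a Lipschitz bound from the previous
stage `k`. -/
lemma norm_stage_sub_le {E : Type*} [NormedAddCommGroup E] [NormedSpace ℝ E]
    {L a K : ℝ} (hL : 0 ≤ L) (ha : 0 ≤ a) {g : E → E}
    (hg : ∀ u v : E, ‖g u - g v‖ ≤ L * ‖u - v‖) {u v x y : E} (hxy : ‖x - y‖ ≤ K) :
    ‖g (u + a • x) - g (v + a • y)‖ ≤ L * (‖u - v‖ + a * K) := by
  refine (hg _ _).trans (mul_le_mul_of_nonneg_left ?_ hL)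
  calc ‖u + a • x - (v + a • y)‖ = ‖(u - v) + a • (x - y)‖ := by
        congr 1; module
    _ ≤ ‖u - v‖ + ‖a • (x - y)‖ := norm_add_le _ _
    _ = ‖u - v‖ + a * ‖x - y‖ := by rw [norm_smul, Real.norm_of_nonneg ha]
    _ ≤ ‖u - v‖ + a * K := by gcongr

/-- The Runge–Kutta increment is Lipschitz in the state variable. -/
lemma norm_rkF4_sub_le {E : Type*} [NormedAddCommGroup E] [NormedSpace ℝ E]
    {L h : ℝ} (hL : 0 ≤ L) (hh : 0 ≤ h) {f : ℝ → E → E}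
    (hf : ∀ t : ℝ, ∀ u v : E, ‖f t u - f t v‖ ≤ L * ‖u - v‖) (t : ℝ) (u v : E) :
    ‖rkF4 f h t u - rkF4 f h t v‖ ≤
      L * (1 + (1 / 2) * h * L + (1 / 6) * h ^ 2 * L ^ 2 +
        (1 / 24) * h ^ 3 * L ^ 3) * ‖u - v‖ := by
  have hh2 : 0 ≤ h / 2 := by positivity
  have h₁ := hf t u v
  have h₂ := norm_stage_sub_le (u := u) (v := v) hL hh2 (hf (t + h / 2)) h₁
  have h₃ := norm_stage_sub_le (u := u) (v := v) hL hh2 (hf (t + h / 2)) h₂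
  have h₄ := norm_stage_sub_le (u := u) (v := v) hL hh (hf (t + h)) h₃
  simp only [rkF4]
  generalize f (t + h) (u + _) = x₄ at *
  generalize f (t + h) (v + _) = y₄ at *
  generalize f (t + h / 2) (u + (h / 2) • f (t + h / 2) _) = x₃ at *
  generalize f (t + h / 2) (v + (h / 2) • f (t + h / 2) _) = y₃ at *
  generalize f (t + h / 2) (u + _) = x₂ at *
  generalize f (t + h / 2) (v + _) = y₂ at *
  generalize f t u = x₁ at *
  generalize f t v = y₁ at *
  calc _ = ‖(1 / 6 : ℝ) • ((x₁ - y₁) + (2 : ℝ) • (x₂ - y₂) + (2 : ℝ) • (x₃ - y₃)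
          + (x₄ - y₄))‖ := by congr 1; module
    _ ≤ 1 / 6 * (‖x₁ - y₁‖ + 2 * ‖x₂ - y₂‖ + 2 * ‖x₃ - y₃‖ + ‖x₄ - y₄‖) := by
        rw [norm_smul, Real.norm_of_nonneg (by norm_num)]
        gcongr
        refine norm_add₄_le.trans_eq ?_
        simp only [norm_smul, Real.norm_ofNat]
    _ ≤ _ := by linarith

/-- For the Euler coarse integrator `C(u) = u + h f(t,u)` and one-step Runge–Kutta fine
integrator `F(u) = u + h F₄(h,t,u;f)`, the difference `F - C` is Lipschitz with
constant `h(L + M)`. -/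
theorem euler_rk4_difference_lipschitz
    {E : Type*} [NormedAddCommGroup E] [NormedSpace ℝ E]
    (L h : ℝ) (hL : 0 < L) (hh : 0 ≤ h)
    (f : ℝ → E → E)
    (hf : ∀ t : ℝ, ∀ u v : E, ‖f t u - f t v‖ ≤ L * ‖u - v‖)
    (t : ℝ)
    (C F : E → E)
    (hC : ∀ u : E, C u = u + h • f t u)
    (hF : ∀ u : E, F u = u + h • rkF4 f h t u) :
    ∀ u v : E,
      ‖(F u - C u) - (F v - C v)‖ ≤
        h * (L + L * (1 + (1 / 2) * h * L + (1 / 6) * h ^ 2 * L ^ 2 +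
          (1 / 24) * h ^ 3 * L ^ 3)) * ‖u - v‖ := by
  intro u v
  have h₁ := hf t u v
  have h₂ := norm_rkF4_sub_le hL.le hh hf t u v
  calc ‖(F u - C u) - (F v - C v)‖
      = ‖h • ((rkF4 f h t u - rkF4 f h t v) - (f t u - f t v))‖ := by
        rw [hF, hF, hC, hC]; congr 1; module
    _ = h * ‖(rkF4 f h t u - rkF4 f h t v) - (f t u - f t v)‖ := by
        rw [norm_smul, Real.norm_of_nonneg hh]
    _ ≤ h * (‖rkF4 f h t u - rkF4 f h t v‖ + ‖f t u - f t v‖) := by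
        gcongr; exact norm_sub_le _ _
    _ ≤ h * ((L + L * (1 + (1 / 2) * h * L + (1 / 6) * h ^ 2 * L ^ 2 +
          (1 / 24) * h ^ 3 * L ^ 3)) * ‖u - v‖) := by
        gcongr; linarith
    _ = _ := by ring
end

section
/- Let L > 0, h > 0, let f : ℝᵈ → ℝᵈ satisfy ‖f(u) − f(v)‖ ≤ L‖u − v‖ for all u, v ∈ ℝᵈ, and let x : [t₀, t₀ + h] → ℝᵈ be differentiable with x'(s) = f(x(s)) for all s ∈ [t₀, t₀ + h] and x(t₀) = u. Then for all s ∈ [t₀, t₀ + h]: ‖x(s) − u‖ ≤ ‖f(u)‖ e^{L h} (s − t₀). -/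
theorem exp_sub_one_le_mul_exp (y : ℝ) : Real.exp y - 1 ≤ y * Real.exp y := by
  have hmul := mul_le_mul_of_nonneg_right (Real.one_sub_le_exp_neg y) (Real.exp_pos y).le
  rw [← Real.exp_add, neg_add_cancel, Real.exp_zero] at hmul
  linarith

theorem gronwallBound_zero_le {K ε y : ℝ} (hK : 0 < K) (hε : 0 ≤ ε) :
    gronwallBound 0 K ε y ≤ ε * Real.exp (K * y) * y := by
  simp only [gronwallBound_of_K_ne_0 hK.ne', zero_mul, zero_add]
  calc ε / K * (Real.exp (K * y) - 1)
      ≤ ε / K * (K * y * Real.exp (K * y)) := by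
        gcongr
        exact exp_sub_one_le_mul_exp _
    _ = ε * Real.exp (K * y) * y := by field_simp

/-- A solution of `x' = f(x)` with `f` Lipschitz stays close to its initial value, in any real
normed space. -/
theorem norm_sub_le_of_lipschitz_ode {E : Type*} [NormedAddCommGroup E] [NormedSpace ℝ E]
    {L h t₀ : ℝ} (hL : 0 < L) {f : E → E} (hf : ∀ u v, ‖f u - f v‖ ≤ L * ‖u - v‖)
    {u : E} {x : ℝ → E}
    (hx : ∀ s ∈ Set.Icc t₀ (t₀ + h), HasDerivWithinAt x (f (x s)) (Set.Icc t₀ (t₀ + h)) s)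
    (hx0 : x t₀ = u) :
    ∀ s ∈ Set.Icc t₀ (t₀ + h), ‖x s - u‖ ≤ ‖f u‖ * Real.exp (L * h) * (s - t₀) := by
  intro s hs
  have hderiv : ∀ r ∈ Set.Ico t₀ (t₀ + h),
      HasDerivWithinAt (fun r => x r - u) (f (x r)) (Set.Ici r) r := fun r hr =>
    ((hx r (Set.Ico_subset_Icc_self hr)).mono_of_mem_nhdsWithin
      (Icc_mem_nhdsGE_of_mem hr)).sub_const u
  have hbound : ∀ r ∈ Set.Ico t₀ (t₀ + h), ‖f (x r)‖ ≤ L * ‖x r - u‖ + ‖f u‖ := fun r _ => by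
    linarith [norm_le_norm_sub_add (f (x r)) (f u), hf (x r) u]
  calc ‖x s - u‖
      ≤ gronwallBound 0 L ‖f u‖ (s - t₀) :=
        norm_le_gronwallBound_of_norm_deriv_right_le
          (fun r hr => ((hx r hr).sub_const u).continuousWithinAt) hderiv (by simp [hx0]) hbound s hs
    _ ≤ ‖f u‖ * Real.exp (L * (s - t₀)) * (s - t₀) :=
        gronwallBound_zero_le hL (norm_nonneg _)
    _ ≤ ‖f u‖ * Real.exp (L * h) * (s - t₀) := by
        have hs_nonneg : 0 ≤ s - t₀ := sub_nonneg.2 hs.1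
        gcongr
        linarith [hs.2]

/-- Growth bound for the exact solution of the autonomous ODE `x' = f(x)`, `x(t₀) = u`:
`‖x(s) − u‖ ≤ ‖f(u)‖ e^{Lh} (s − t₀)` on `[t₀, t₀ + h]`. -/
theorem ode_solution_growth_bound
    (d : ℕ) (L h : ℝ) (hL : 0 < L) (hh : 0 < h)
    (f : EuclideanSpace ℝ (Fin d) → EuclideanSpace ℝ (Fin d))
    (hf : ∀ u v : EuclideanSpace ℝ (Fin d), ‖f u - f v‖ ≤ L * ‖u - v‖)
    (t₀ : ℝ) (u : EuclideanSpace ℝ (Fin d))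
    (x : ℝ → EuclideanSpace ℝ (Fin d))
    (hx : ∀ s ∈ Set.Icc t₀ (t₀ + h),
      HasDerivWithinAt x (f (x s)) (Set.Icc t₀ (t₀ + h)) s)
    (hx0 : x t₀ = u) :
    ∀ s ∈ Set.Icc t₀ (t₀ + h),
      ‖x s - u‖ ≤ ‖f u‖ * Real.exp (L * h) * (s - t₀) := by
  exact norm_sub_le_of_lipschitz_ode hL hf hx hx0
end
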